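/- arXiv:2004.05015 — 7 statements merged into one kernel-verified Lean document; each statement's English description precedes it below -/
import Mathlib

section
/- Let R > 0 and let φ : ℝ² → ℝ be twice continuously differentiable on {(v,T) : v > 0, T > 0}. Define e(v,T) = R·T²·φ_T(v,T) and p(v,T) = R·T·φ_v(v,T). Then for every v > 0, T > 0 and every tangent vector (δv, δT) ∈ ℝ², the value of the differential quadratic form κ = d(T⁻¹)·de + d(pT⁻¹)·dv on (δv,δT), namely (−T⁻² δT)·(e_v δv + e_T δT) + ((p/T)_v δv + (p/T)_T δT)·δv, equals R·( −(φ_TT + 2T⁻¹ φ_T)·δT² + φ_vv·δv² ). -/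
open scoped Topology

/-- Partial derivatives of a `C²` function of two real variables commute. -/
lemma hasDerivAt_mixed_partials_eq {f fx fy : ℝ → ℝ → ℝ} {x y a b : ℝ}
    (hf : ContDiffAt ℝ 2 (fun q : ℝ × ℝ => f q.1 q.2) (x, y))
    (hfx : ∀ᶠ q : ℝ × ℝ in 𝓝 (x, y), HasDerivAt (fun t => f t q.2) (fx q.1 q.2) q.1)
    (hfy : ∀ᶠ q : ℝ × ℝ in 𝓝 (x, y), HasDerivAt (fun t => f q.1 t) (fy q.1 q.2) q.2)
    (ha : HasDerivAt (fun t => fy t y) a x) (hb : HasDerivAt (fun t => fx x t) b y) :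
    a = b := by
  set F : ℝ × ℝ → ℝ := fun q => f q.1 q.2 with hF
  have hdiff : ∀ᶠ q in 𝓝 (x, y), DifferentiableAt ℝ F q :=
    (hf.eventually (by simp)).mono fun q hq => hq.differentiableAt (by simp)
  have horiz (s t : ℝ) : HasDerivAt (fun r : ℝ => (r, t)) ((1 : ℝ), (0 : ℝ)) s :=
    (hasDerivAt_id s).prodMk (hasDerivAt_const s t)
  have vert (s t : ℝ) : HasDerivAt (fun r : ℝ => (s, r)) ((0 : ℝ), (1 : ℝ)) t :=
    (hasDerivAt_const t s).prodMk (hasDerivAt_id t)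
  have hx : ∀ᶠ q in 𝓝 (x, y), fx q.1 q.2 = fderiv ℝ F q (1, 0) := by
    filter_upwards [hdiff, hfx] with q hq hq'
    exact hq'.unique (HasFDerivAt.comp_hasDerivAt (l := F) (f := fun r => (r, q.2)) q.1
      hq.hasFDerivAt (horiz q.1 q.2))
  have hy : ∀ᶠ q in 𝓝 (x, y), fy q.1 q.2 = fderiv ℝ F q (0, 1) := by
    filter_upwards [hdiff, hfy] with q hq hq'
    exact hq'.unique (HasFDerivAt.comp_hasDerivAt (l := F) (f := fun r => (q.1, r)) q.2
      hq.hasFDerivAt (vert q.1 q.2))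
  have hF2 : HasFDerivAt (fderiv ℝ F) (fderiv ℝ (fderiv ℝ F) (x, y)) (x, y) :=
    ((hf.fderiv_right (m := 1) (by norm_num)).differentiableAt (by simp)).hasFDerivAt
  have happly (w : ℝ × ℝ) : HasFDerivAt (fun q => fderiv ℝ F q w)
      ((ContinuousLinearMap.apply ℝ ℝ w).comp (fderiv ℝ (fderiv ℝ F) (x, y))) (x, y) :=
    (ContinuousLinearMap.apply ℝ ℝ w).hasFDerivAt.comp (x, y) hF2
  have hsymm : IsSymmSndFDerivAt ℝ F (x, y) := hf.isSymmSndFDerivAt (by simp)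
  have ha' : HasDerivAt (fun t => fy t y) (fderiv ℝ (fderiv ℝ F) (x, y) (1, 0) (0, 1)) x := by
    have h := (happly (0, 1)).comp_hasDerivAt (f := fun t => (t, y)) x (horiz x y)
    exact h.congr_of_eventuallyEq ((horiz x y).continuousAt.eventually hy)
  have hb' : HasDerivAt (fun t => fx x t) (fderiv ℝ (fderiv ℝ F) (x, y) (0, 1) (1, 0)) y := by
    have h := (happly (1, 0)).comp_hasDerivAt (f := fun t => (x, t)) y (vert x y)
    exact h.congr_of_eventuallyEq ((vert x y).continuousAt.eventually hx)
  rw [ha.unique ha', hb.unique hb']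
  exact hsymm.eq _ _

/-- **Restriction of the pseudo-Riemannian form `κ` to the state manifold.**
Let `R > 0` and let `φ` be twice continuously differentiable on
`{(v,T) : v > 0, T > 0}`, with first partials `φv, φT` and second partials
`φvv = (φ_v)_v`, `φTT = (φ_T)_T` (encoded as `HasDerivAt` hypotheses).
Define `e = R T² φ_T` and `p = R T φ_v`.  Then for every `v > 0`, `T > 0`
and every tangent vector `(δv, δT)`, the value of
`κ = d(T⁻¹)·de + d(pT⁻¹)·dv` on `(δv, δT)`, namely
`(−T⁻² δT)(e_v δv + e_T δT) + ((p/T)_v δv + (p/T)_T δT) δv`,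
equals `R(−(φ_TT + 2T⁻¹φ_T) δT² + φ_vv δv²)`. -/
theorem kappa_restriction_massieu_planck
    (R : ℝ) (hR : 0 < R)
    (φ φv φT φvv φTT : ℝ → ℝ → ℝ)
    (hC2 : ContDiffOn ℝ 2 (fun q : ℝ × ℝ => φ q.1 q.2) {q : ℝ × ℝ | 0 < q.1 ∧ 0 < q.2})
    (hφv : ∀ v T : ℝ, 0 < v → 0 < T → HasDerivAt (fun v' => φ v' T) (φv v T) v)
    (hφT : ∀ v T : ℝ, 0 < v → 0 < T → HasDerivAt (fun T' => φ v T') (φT v T) T)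
    (hφvv : ∀ v T : ℝ, 0 < v → 0 < T → HasDerivAt (fun v' => φv v' T) (φvv v T) v)
    (hφTT : ∀ v T : ℝ, 0 < v → 0 < T → HasDerivAt (fun T' => φT v T') (φTT v T) T)
    (e p : ℝ → ℝ → ℝ)
    (he : ∀ v T, e v T = R * T ^ 2 * φT v T)
    (hp : ∀ v T, p v T = R * T * φv v T)
    (v T : ℝ) (hv : 0 < v) (hT : 0 < T) (δv δT : ℝ) :
    ∀ ev eT qv qT : ℝ,
      HasDerivAt (fun v' => e v' T) ev v →
      HasDerivAt (fun T' => e v T') eT T →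
      HasDerivAt (fun v' => p v' T / T) qv v →
      HasDerivAt (fun T' => p v T' / T') qT T →
      (-T⁻¹ ^ 2 * δT) * (ev * δv + eT * δT) + (qv * δv + qT * δT) * δv =
        R * (-(φTT v T + 2 * T⁻¹ * φT v T) * δT ^ 2 + φvv v T * δv ^ 2) := by
  intro ev eT qv qT hev heT hqv hqT
  have hR0 : R ≠ 0 := hR.ne'
  have hT0 : T ≠ 0 := hT.ne'
  have hnhds : {q : ℝ × ℝ | 0 < q.1 ∧ 0 < q.2} ∈ 𝓝 (v, T) :=
    ((isOpen_lt continuous_const continuous_fst).inter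
      (isOpen_lt continuous_const continuous_snd)).mem_nhds ⟨hv, hT⟩
  have ha : HasDerivAt (fun v' => φT v' T) (ev / (R * T ^ 2)) v := by
    refine (hev.div_const (R * T ^ 2)).congr_of_eventuallyEq (.of_forall fun v' => ?_)
    simp only [he]
    field_simp
  have hb : HasDerivAt (fun T' => φv v T') (qT / R) T := by
    refine (hqT.div_const R).congr_of_eventuallyEq ?_
    filter_upwards [lt_mem_nhds hT] with T' hT'
    simp only [hp]
    field_simp
  have hmixed : ev / (R * T ^ 2) = qT / R :=
    hasDerivAt_mixed_partials_eq (hC2.contDiffAt hnhds)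
      (Filter.mem_of_superset hnhds fun q hq => hφv q.1 q.2 hq.1 hq.2)
      (Filter.mem_of_superset hnhds fun q hq => hφT q.1 q.2 hq.1 hq.2) ha hb
  have hev_eq : ev = T ^ 2 * qT := by
    field_simp at hmixed
    linarith
  have heT_eq : eT = R * (2 * T) * φT v T + R * T ^ 2 * φTT v T := by
    simp only [he] at heT
    refine heT.unique ?_
    simpa using ((hasDerivAt_pow 2 T).const_mul R).fun_mul (hφTT v T hv hT)
  have hqv_eq : qv = R * φvv v T := by
    simp only [hp] at hqv
    refine (hqv.unique (((hφvv v T hv hT).const_mul (R * T)).div_const T)).trans ?_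
    field_simp
  rw [hev_eq, heT_eq, hqv_eq]
  field_simp
  ring
end

section
/- Let u ∈ ℝ, ρ > 0, c > 0, set A = √c / ρ, and assume u ≠ ρA and u ≠ −ρA. Let W = (1/(ρA)) · [[u, −1, 0, 0], [u² − ρ²A², −u, 0, 0], [0, 0, 0, ρA²], [0, 0, ρ, 0]] (rows and columns indexed by coordinates t, x, u, ρ in this order). Define the vectors X₊ = (0, 0, A, 1), X₋ = (0, 0, −A, 1), Y₊ = ((u − ρA)⁻¹, 1, 0, 0), Y₋ = ((u + ρA)⁻¹, 1, 0, 0) in ℝ⁴. Then W·X₊ = X₊, W·Y₊ = Y₊, W·X₋ = −X₋, and W·Y₋ = −Y₋. -/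
/-- **Eigenvectors of the matrix `W` of the operator `A_ω`.**
For `u ∈ ℝ`, `ρ > 0`, `c > 0`, `A = √c/ρ`, `u ≠ ρA`, `u ≠ −ρA`, the matrix
`W = (1/(ρA)) · [[u, −1, 0, 0], [u² − ρ²A², −u, 0, 0], [0,0,0,ρA²], [0,0,ρ,0]]`
(rows/columns indexed by coordinates `t, x, u, ρ`) satisfies
`W X₊ = X₊`, `W Y₊ = Y₊`, `W X₋ = −X₋`, `W Y₋ = −Y₋`, where
`X₊ = (0,0,A,1)`, `X₋ = (0,0,−A,1)`, `Y₊ = ((u−ρA)⁻¹,1,0,0)`,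
`Y₋ = ((u+ρA)⁻¹,1,0,0)`. -/
theorem euler_characteristic_eigenvectors
    (u ρ c A : ℝ) (hρ : 0 < ρ) (hc : 0 < c) (hA : A = Real.sqrt c / ρ)
    (h₁ : u ≠ ρ * A) (h₂ : u ≠ -(ρ * A))
    (W : Matrix (Fin 4) (Fin 4) ℝ)
    (hW : W = (1 / (ρ * A)) •
      !![u, -1, 0, 0;
         u ^ 2 - ρ ^ 2 * A ^ 2, -u, 0, 0;
         0, 0, 0, ρ * A ^ 2;
         0, 0, ρ, 0])
    (Xp Xm Yp Ym : Fin 4 → ℝ)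
    (hXp : Xp = ![0, 0, A, 1]) (hXm : Xm = ![0, 0, -A, 1])
    (hYp : Yp = ![(u - ρ * A)⁻¹, 1, 0, 0]) (hYm : Ym = ![(u + ρ * A)⁻¹, 1, 0, 0]) :
    W.mulVec Xp = Xp ∧ W.mulVec Yp = Yp ∧
      W.mulVec Xm = -Xm ∧ W.mulVec Ym = -Ym := by
  have hA₀ : A ≠ 0 := by
    rw [hA]
    positivity
  have hρ₀ : ρ ≠ 0 := hρ.ne'
  have hm : u - A * ρ ≠ 0 := by rwa [mul_comm, sub_ne_zero]
  have hp : u + A * ρ ≠ 0 := by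
    rw [mul_comm]
    exact fun h => h₂ (eq_neg_of_add_eq_zero_left h)
  subst hW hXp hXm hYp hYm
  refine ⟨?_, ?_, ?_, ?_⟩ <;> ext i <;> fin_cases i <;>
    simp [Matrix.mulVec, dotProduct, Fin.sum_univ_four] <;> field_simp <;> ring
end

section
/- Let A : ℝ → ℝ be continuously differentiable, and let Ω = {(t,x,u,ρ) ∈ ℝ⁴ : ρ > 0 and u ≠ ρ·A(ρ)}. Define vector fields on Ω (components in the coordinate order (t,x,u,ρ)): X(t,x,u,ρ) = (0, 0, A(ρ), 1) and Y(t,x,u,ρ) = ((u − ρA(ρ))⁻¹, 1, 0, 0). Then at every point q = (t,x,u,ρ) ∈ Ω the Lie bracket [X,Y](q) := DY(q)·X(q) − DX(q)·Y(q) equals (ρ·A′(ρ)·(u − ρA(ρ))⁻², 0, 0, 0); moreover [X,Y](q) lies in the linear span of X(q) and Y(q) if and only if A′(ρ) = 0. -/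
/-- The derivative of the field `(0, 0, A(ρ), 1)`. -/
theorem hasFDerivAt_characteristic_fst {A : ℝ → ℝ} {q : Fin 4 → ℝ} {a : ℝ}
    (hA : HasDerivAt A a (q 3)) :
    HasFDerivAt (fun p : Fin 4 → ℝ => (![0, 0, A (p 3), 1] : Fin 4 → ℝ))
      (ContinuousLinearMap.pi
        ![0, 0, a • ContinuousLinearMap.proj (R := ℝ) (φ := fun _ : Fin 4 => ℝ) 3, 0]) q := by
  rw [hasFDerivAt_pi]
  intro i
  fin_cases i
  · exact hasFDerivAt_const _ _
  · exact hasFDerivAt_const _ _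
  · exact hA.comp_hasFDerivAt q (hasFDerivAt_apply 3 q)
  · exact hasFDerivAt_const _ _

/-- The derivative of the field `((u - ρ A(ρ))⁻¹, 1, 0, 0)` where `u ≠ ρ A(ρ)`. -/
theorem hasFDerivAt_characteristic_snd {A : ℝ → ℝ} {q : Fin 4 → ℝ} {a : ℝ}
    (hA : HasDerivAt A a (q 3)) (hq : q 2 - q 3 * A (q 3) ≠ 0) :
    HasFDerivAt (fun p : Fin 4 → ℝ => (![(p 2 - p 3 * A (p 3))⁻¹, 1, 0, 0] : Fin 4 → ℝ))
      (ContinuousLinearMap.pi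
        ![(-((q 2 - q 3 * A (q 3)) ^ 2)⁻¹) •
            (ContinuousLinearMap.proj (R := ℝ) (φ := fun _ : Fin 4 => ℝ) 2 -
              (1 * A (q 3) + q 3 * a) •
                ContinuousLinearMap.proj (R := ℝ) (φ := fun _ : Fin 4 => ℝ) 3),
          0, 0, 0]) q := by
  rw [hasFDerivAt_pi]
  intro i
  fin_cases i
  · have hprod : HasDerivAt (fun r : ℝ => r * A r) (1 * A (q 3) + q 3 * a) (q 3) :=
      (hasDerivAt_id (q 3)).mul hA
    have hproj (j : Fin 4) : HasFDerivAt (fun p : Fin 4 → ℝ => p j)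
        (ContinuousLinearMap.proj (R := ℝ) (φ := fun _ : Fin 4 => ℝ) j) q :=
      hasFDerivAt_apply j q
    exact (hasDerivAt_inv hq).comp_hasFDerivAt q
      ((hproj 2).sub (hprod.comp_hasFDerivAt (f := fun p : Fin 4 → ℝ => p 3) q (hproj 3)))
  · exact hasFDerivAt_const _ _
  · exact hasFDerivAt_const _ _
  · exact hasFDerivAt_const _ _

/-- A multiple of `∂_t` lies in the span of `α ∂_u + ∂_ρ` and `β ∂_t + ∂_x` only if it is zero. -/
theorem vec_mem_span_characteristic_iff {c α β : ℝ} :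
    (![c, 0, 0, 0] : Fin 4 → ℝ) ∈
      Submodule.span ℝ {(![0, 0, α, 1] : Fin 4 → ℝ), ![β, 1, 0, 0]} ↔ c = 0 := by
  rw [Submodule.mem_span_pair]
  constructor
  · rintro ⟨x, y, h⟩
    have h0 := congrFun h 0
    have h1 := congrFun h 1
    simp at h0 h1
    simpa [h1] using h0.symm
  · rintro rfl
    refine ⟨0, 0, ?_⟩
    ext i
    fin_cases i <;> simp

/-- **Lie bracket of the generators of a characteristic distribution.**
Let `A : ℝ → ℝ` be `C¹` and `Ω = {(t,x,u,ρ) : ρ > 0, u ≠ ρ A(ρ)}`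
(points of `ℝ⁴` with coordinate order `(t,x,u,ρ)`).  For the vector fields
`X(q) = (0,0,A(ρ),1)` and `Y(q) = ((u − ρA(ρ))⁻¹, 1, 0, 0)`, at every `q ∈ Ω`
the Lie bracket `[X,Y](q) = DY(q)·X(q) − DX(q)·Y(q)` equals
`(ρ A′(ρ) (u − ρA(ρ))⁻², 0, 0, 0)`, and it lies in the span of `X(q)` and
`Y(q)` iff `A′(ρ) = 0`. -/
theorem characteristic_distribution_bracket
    (A : ℝ → ℝ) (hA : ContDiff ℝ 1 A)
    (Ω : Set (Fin 4 → ℝ))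
    (hΩ : Ω = {q : Fin 4 → ℝ | 0 < q 3 ∧ q 2 ≠ q 3 * A (q 3)})
    (X Y : (Fin 4 → ℝ) → (Fin 4 → ℝ))
    (hX : ∀ q, X q = ![0, 0, A (q 3), 1])
    (hY : ∀ q ∈ Ω, Y q = ![(q 2 - q 3 * A (q 3))⁻¹, 1, 0, 0]) :
    ∀ q ∈ Ω,
      fderiv ℝ Y q (X q) - fderiv ℝ X q (Y q) =
        ![q 3 * deriv A (q 3) * ((q 2 - q 3 * A (q 3))⁻¹) ^ 2, 0, 0, 0] ∧
      ((fderiv ℝ Y q (X q) - fderiv ℝ X q (Y q)) ∈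
          Submodule.span ℝ {X q, Y q} ↔ deriv A (q 3) = 0) := by
  intro q hq
  have hYq := hY q hq
  have hΩo : IsOpen Ω := by
    have hAc := hA.continuous
    rw [hΩ]
    exact (isOpen_lt continuous_const (continuous_apply 3)).inter
      (isOpen_ne_fun (continuous_apply 2)
        ((continuous_apply 3).mul (hAc.comp (continuous_apply 3))))
  obtain ⟨hρ, hu⟩ : 0 < q 3 ∧ q 2 ≠ q 3 * A (q 3) := by simpa [hΩ] using hq
  have hw : q 2 - q 3 * A (q 3) ≠ 0 := sub_ne_zero.mpr hu
  have hA' : HasDerivAt A (deriv A (q 3)) (q 3) :=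
    (hA.differentiable one_ne_zero _).hasDerivAt
  have hDX := ((hasFDerivAt_characteristic_fst hA').congr_of_eventuallyEq
    (Filter.Eventually.of_forall hX)).fderiv
  have hDY :=
    ((hasFDerivAt_characteristic_snd hA' hw).congr_of_eventuallyEq
      (Filter.eventually_of_mem (hΩo.mem_nhds hq) hY)).fderiv
  have hbr : fderiv ℝ Y q (X q) - fderiv ℝ X q (Y q) =
      ![q 3 * deriv A (q 3) * ((q 2 - q 3 * A (q 3))⁻¹) ^ 2, 0, 0, 0] := by
    rw [hDX, hDY, hX q, hYq]
    ext i
    fin_cases i <;> simp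
    ring
  refine ⟨hbr, ?_⟩
  rw [hbr, hX q, hYq, vec_mem_span_characteristic_iff]
  simp [hρ.ne', hw]
end

section
/- Let A ∈ ℝ and let α₀, α₁, α₂, α₃ be real constants. Define f : ℝ³ → ℝ by f(t,u,ρ) = α₀ + α₁ρ + α₂ρt − u(ρ + α₃). Then at every point (t,u,ρ) the identity −2ρA² f_u f_t f_{ut} − ρ f_ρ² f_{tt} − ρ f_t² f_{ρρ} + ρA²( f_u² f_{tt} + f_t² f_{uu} ) + 2ρ f_ρ f_t f_{ρt} − 2 f_ρ f_t² = 0 holds, where subscripts denote partial derivatives. -/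
/-- **An exact solution of the integrability PDE.**
Let `A ∈ ℝ` and `α₀, α₁, α₂, α₃` be real constants, and
`f(t,u,ρ) = α₀ + α₁ρ + α₂ρt − u(ρ + α₃)`.  Then at every point `(t,u,ρ)`
`−2ρA² f_u f_t f_{ut} − ρ f_ρ² f_{tt} − ρ f_t² f_{ρρ}
 + ρA²(f_u² f_{tt} + f_t² f_{uu}) + 2ρ f_ρ f_t f_{ρt} − 2 f_ρ f_t² = 0`,
where subscripts denote partial derivatives. -/
theorem affine_solution_of_integrability_PDE
    (A α₀ α₁ α₂ α₃ : ℝ) (f : ℝ → ℝ → ℝ → ℝ)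
    (hf : ∀ t u ρ : ℝ, f t u ρ = α₀ + α₁ * ρ + α₂ * ρ * t - u * (ρ + α₃))
    (t u ρ : ℝ) :
    let ft := deriv (fun t' => f t' u ρ) t
    let fu := deriv (fun u' => f t u' ρ) u
    let fρ := deriv (fun ρ' => f t u ρ') ρ
    let ftt := deriv (fun t' => deriv (fun t'' => f t'' u ρ) t') t
    let fuu := deriv (fun u' => deriv (fun u'' => f t u'' ρ) u') u
    let fρρ := deriv (fun ρ' => deriv (fun ρ'' => f t u ρ'') ρ') ρ
    let fut := deriv (fun t' => deriv (fun u' => f t' u' ρ) u) t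
    let fρt := deriv (fun t' => deriv (fun ρ' => f t' u ρ') ρ) t
    (-2 * ρ * A ^ 2 * fu * ft * fut - ρ * fρ ^ 2 * ftt - ρ * ft ^ 2 * fρρ
      + ρ * A ^ 2 * (fu ^ 2 * ftt + ft ^ 2 * fuu)
      + 2 * ρ * fρ * ft * fρt - 2 * fρ * ft ^ 2) = 0 := by
  have ht (t u ρ : ℝ) : deriv (fun t' => f t' u ρ) t = α₂ * ρ := by
    have h : (fun t' => f t' u ρ) = fun t' => α₂ * ρ * t' + (α₀ + α₁ * ρ - u * (ρ + α₃)) := by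
      funext t'; rw [hf]; ring
    rw [h]; simp
  have hu (t u ρ : ℝ) : deriv (fun u' => f t u' ρ) u = -(ρ + α₃) := by
    have h : (fun u' => f t u' ρ) = fun u' => -(ρ + α₃) * u' + (α₀ + α₁ * ρ + α₂ * ρ * t) := by
      funext u'; rw [hf]; ring
    rw [h, deriv_add_const, deriv_const_mul_field, deriv_id'', mul_one]
  have hρ (t u ρ : ℝ) : deriv (fun ρ' => f t u ρ') ρ = α₂ * t + (α₁ - u) := by
    have h : (fun ρ' => f t u ρ') = fun ρ' => (α₂ * t + (α₁ - u)) * ρ' + (α₀ - u * α₃) := by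
      funext ρ'; rw [hf]; ring
    rw [h, deriv_add_const, deriv_const_mul_field, deriv_id'', mul_one]
  have hρt : deriv (fun t' => α₂ * t' + (α₁ - u)) t = α₂ := by simp
  simp only [ht, hu, hρ, hρt, deriv_const]
  ring
end

section
/- Let A : (0,∞) → ℝ be continuous, let α₀, α₁, α₃ ∈ ℝ and α₂ ≠ 0, and let P : (0,∞) → ℝ satisfy P′(ρ) = A(ρ)²(ρ+α₃)/α₂. On the open set of (t,x,ρ) ∈ ℝ² × (0,∞) with ρ + α₃ ≠ 0, define Φ(t,x,ρ) = P(ρ) + (α₁α₃ − α₀)²/(2α₂(ρ+α₃)²) + [ 2x(ρ+α₃)² − 2t(ρ²α₁ + α₃(α₀ + 2ρα₁)) − ρα₂(ρ+2α₃)t² ] / (2(ρ+α₃)²). Define, for each sign choice ±, the vector field Z_± with ∂_t-component a_± = (A(ρ)(ρ+α₃)² ∓ α₃(α₁ + tα₂) ± α₀)/(ρ+α₃)², ∂_ρ-component ±α₂ρ/(ρ+α₃), and ∂_x-component a_± · (∓A(ρ)ρ(ρ+α₃) + ρ(tα₂+α₁) + α₀)/(ρ+α₃). Then Φ is a first integral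 of both Z₊ and Z₋, i.e. a_±·∂Φ/∂t + (±α₂ρ/(ρ+α₃))·∂Φ/∂ρ + (∂_x-component)·∂Φ/∂x = 0 at every point of the domain, for both sign choices. -/
/-- **`Φ` is a common first integral of the characteristic fields `Z₊`, `Z₋`.**
Let `A : (0,∞) → ℝ` be continuous, `α₂ ≠ 0`, and `P` satisfy
`P′(ρ) = A(ρ)²(ρ+α₃)/α₂` on `(0,∞)`.  On `{ρ > 0, ρ+α₃ ≠ 0}` define
`Φ(t,x,ρ) = P(ρ) + (α₁α₃−α₀)²/(2α₂(ρ+α₃)²)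
  + (2x(ρ+α₃)² − 2t(ρ²α₁+α₃(α₀+2ρα₁)) − ρα₂(ρ+2α₃)t²)/(2(ρ+α₃)²)`.
Then for both sign choices `±`, the vector field `Z_±` with
`∂_t`-component `a_± = (A(ρ)(ρ+α₃)² ∓ α₃(α₁+tα₂) ± α₀)/(ρ+α₃)²`,
`∂_ρ`-component `±α₂ρ/(ρ+α₃)` and
`∂_x`-component `a_± (∓A(ρ)ρ(ρ+α₃) + ρ(tα₂+α₁) + α₀)/(ρ+α₃)`
annihilates `Φ`. -/
theorem first_integral_of_characteristic_fields
    (A P : ℝ → ℝ) (α₀ α₁ α₂ α₃ : ℝ) (hα₂ : α₂ ≠ 0)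
    (hA : ContinuousOn A (Set.Ioi 0))
    (hP : ∀ ρ ∈ Set.Ioi (0 : ℝ), HasDerivAt P (A ρ ^ 2 * (ρ + α₃) / α₂) ρ)
    (Φ : ℝ → ℝ → ℝ → ℝ)
    (hΦ : ∀ t x ρ : ℝ, Φ t x ρ =
      P ρ + (α₁ * α₃ - α₀) ^ 2 / (2 * α₂ * (ρ + α₃) ^ 2) +
        (2 * x * (ρ + α₃) ^ 2 - 2 * t * (ρ ^ 2 * α₁ + α₃ * (α₀ + 2 * ρ * α₁)) -
            ρ * α₂ * (ρ + 2 * α₃) * t ^ 2) / (2 * (ρ + α₃) ^ 2))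
    (t x ρ : ℝ) (hρ : 0 < ρ) (hρ₃ : ρ + α₃ ≠ 0) :
    ((A ρ * (ρ + α₃) ^ 2 - α₃ * (α₁ + t * α₂) + α₀) / (ρ + α₃) ^ 2) *
          deriv (fun t' => Φ t' x ρ) t +
        (α₂ * ρ / (ρ + α₃)) * deriv (fun ρ' => Φ t x ρ') ρ +
        (((A ρ * (ρ + α₃) ^ 2 - α₃ * (α₁ + t * α₂) + α₀) / (ρ + α₃) ^ 2) *
            ((-(A ρ * ρ * (ρ + α₃)) + ρ * (t * α₂ + α₁) + α₀) / (ρ + α₃))) *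
          deriv (fun x' => Φ t x' ρ) x = 0 ∧
      ((A ρ * (ρ + α₃) ^ 2 + α₃ * (α₁ + t * α₂) - α₀) / (ρ + α₃) ^ 2) *
          deriv (fun t' => Φ t' x ρ) t +
        (-(α₂ * ρ) / (ρ + α₃)) * deriv (fun ρ' => Φ t x ρ') ρ +
        (((A ρ * (ρ + α₃) ^ 2 + α₃ * (α₁ + t * α₂) - α₀) / (ρ + α₃) ^ 2) *
            ((A ρ * ρ * (ρ + α₃) + ρ * (t * α₂ + α₁) + α₀) / (ρ + α₃))) *
          deriv (fun x' => Φ t x' ρ) x = 0 := by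
  have hs : HasDerivAt (fun r : ℝ => r + α₃) 1 ρ := (hasDerivAt_id ρ).add_const α₃
  have hΦ' : ∀ t x r : ℝ, r + α₃ ≠ 0 → Φ t x r = P r + x - t * α₁ - α₂ * t ^ 2 / 2 +
      (α₁ * α₃ - α₀ + α₂ * α₃ * t) ^ 2 / (2 * α₂) / (r + α₃) ^ 2 := by
    intro t x r hr
    rw [hΦ]
    field_simp
    ring
  have ht : HasDerivAt (fun t' => Φ t' x ρ)
      (-α₁ - α₂ * t + α₃ * (α₁ * α₃ - α₀ + α₂ * α₃ * t) / (ρ + α₃) ^ 2) t := by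
    simp only [hΦ' _ _ ρ hρ₃]
    have hm : HasDerivAt (fun t' : ℝ => α₁ * α₃ - α₀ + α₂ * α₃ * t') (α₂ * α₃ * 1) t :=
      ((hasDerivAt_id t).const_mul _).const_add _
    refine HasDerivAt.congr_deriv ((((((hasDerivAt_id t).mul_const α₁).const_sub (P ρ + x)).sub
      ((((hasDerivAt_id t).pow 2).const_mul α₂).div_const 2)).add
      (((hm.pow 2).div_const (2 * α₂)).div_const ((ρ + α₃) ^ 2)))) ?_
    simp
    field_simp
  have hx : HasDerivAt (fun x' => Φ t x' ρ) 1 x := by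
    simp only [hΦ' _ _ ρ hρ₃]
    exact ((((hasDerivAt_id x).const_add _).sub_const _).sub_const _).add_const _
  have hr : HasDerivAt (fun ρ' => Φ t x ρ') (A ρ ^ 2 * (ρ + α₃) / α₂ -
      (α₁ * α₃ - α₀ + α₂ * α₃ * t) ^ 2 / (α₂ * (ρ + α₃) ^ 3)) ρ := by
    have heq : (fun ρ' => Φ t x ρ') =ᶠ[nhds ρ] fun r => P r + x - t * α₁ - α₂ * t ^ 2 / 2 +
        (α₁ * α₃ - α₀ + α₂ * α₃ * t) ^ 2 / (2 * α₂) / (r + α₃) ^ 2 := by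
      filter_upwards [hs.continuousAt.eventually_ne hρ₃] with r hr using hΦ' t x r hr
    refine HasDerivAt.congr_of_eventuallyEq ?_ heq
    refine HasDerivAt.congr_deriv (((((hP ρ hρ).add_const x).sub_const (t * α₁)).sub_const
      (α₂ * t ^ 2 / 2)).add (((hasDerivAt_const ρ
      ((α₁ * α₃ - α₀ + α₂ * α₃ * t) ^ 2 / (2 * α₂))).div (hs.pow 2) (pow_ne_zero 2 hρ₃)))) ?_
    simp
    field_simp
    ring
  rw [ht.deriv, hr.deriv, hx.deriv]
  constructor
  · field_simp
    ring
  · field_simp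
    ring
end

section
/- Let A : (0,∞) → ℝ be continuously differentiable, let α₀, α₁, α₃ ∈ ℝ and α₂ ≠ 0, let P : (0,∞) → ℝ satisfy P′(ρ) = A(ρ)²(ρ+α₃)/α₂, and let Φ(t,x,ρ) = P(ρ) + (α₁α₃ − α₀)²/(2α₂(ρ+α₃)²) + [ 2x(ρ+α₃)² − 2t(ρ²α₁ + α₃(α₀ + 2ρα₁)) − ρα₂(ρ+2α₃)t² ] / (2(ρ+α₃)²). Let Ω ⊆ ℝ² be open and ρ : Ω → (0,∞) be continuously differentiable with ρ(t,x) + α₃ ≠ 0, such that Φ(t, x, ρ(t,x)) = 0 and ∂Φ/∂ρ (t,x,ρ(t,x)) ≠ 0 for all (t,x) ∈ Ω. Define u(t,x) = (α₂ ρ(t,x) t + α₁ ρ(t,x) + α₀)/(ρ(t,x) + α₃). Then on Ω the pair (ρ, u) satisfies the Euler system: ρ_t + (ρu)_x = 0 and u_t + u u_x + ρ A(ρ)² ρ_x = 0. -/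
/-- Derivative of the implicit phase along a curve `w ↦ (T w, X w, R w)`. -/
theorem hasDerivAt_phase {P T X R : ℝ → ℝ} {α₀ α₁ α₂ α₃ p T' X' R' w : ℝ} (hα₂ : α₂ ≠ 0)
    (hs : R w + α₃ ≠ 0) (hP : HasDerivAt P p (R w)) (hT : HasDerivAt T T' w)
    (hX : HasDerivAt X X' w) (hR : HasDerivAt R R' w) :
    HasDerivAt (fun v => P (R v) + (α₁ * α₃ - α₀) ^ 2 / (2 * α₂ * (R v + α₃) ^ 2) +
      (2 * X v * (R v + α₃) ^ 2 - 2 * T v * (R v ^ 2 * α₁ + α₃ * (α₀ + 2 * R v * α₁)) -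
        R v * α₂ * (R v + 2 * α₃) * T v ^ 2) / (2 * (R v + α₃) ^ 2))
      ((p - (α₃ * α₂ * T w + (α₁ * α₃ - α₀)) ^ 2 / (α₂ * (R w + α₃) ^ 3)) * R' + X' +
        (α₃ * (α₃ * α₂ * T w + (α₁ * α₃ - α₀)) / (R w + α₃) ^ 2 - α₁ - α₂ * T w) * T') w := by
  have hs2 := (hR.add_const α₃).pow 2
  have hnum := (((hX.const_mul 2).mul hs2).sub ((hT.const_mul 2).mul
    (((hR.pow 2).mul_const α₁).add ((((hR.const_mul 2).mul_const α₁).const_add α₀).const_mul α₃)))).sub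
    (((hR.mul_const α₂).mul (hR.add_const (2 * α₃))).mul (hT.pow 2))
  have h := ((hP.comp w hR).add ((hasDerivAt_const w ((α₁ * α₃ - α₀) ^ 2)).div
    (hs2.const_mul (2 * α₂)) (by simp [hα₂, hs]))).add
    (hnum.div (hs2.const_mul 2) (by simp [hs]))
  refine h.congr_deriv ?_
  simp only [Pi.mul_apply, Pi.pow_apply, Pi.sub_apply, Pi.add_apply]
  field_simp
  ring

/-- Derivative of the velocity along a curve `w ↦ (T w, R w)`. -/
theorem hasDerivAt_velocity {T R : ℝ → ℝ} {α₀ α₁ α₂ α₃ T' R' w : ℝ}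
    (hs : R w + α₃ ≠ 0) (hT : HasDerivAt T T' w) (hR : HasDerivAt R R' w) :
    HasDerivAt (fun v => (α₂ * R v * T v + α₁ * R v + α₀) / (R v + α₃))
      (α₂ * R w / (R w + α₃) * T' +
        (α₃ * α₂ * T w + (α₁ * α₃ - α₀)) / (R w + α₃) ^ 2 * R') w := by
  have h := ((((hR.const_mul α₂).mul hT).add (hR.const_mul α₁)).add_const α₀).div
    (hR.add_const α₃) hs
  refine h.congr_deriv ?_
  simp only [Pi.mul_apply, Pi.add_apply]
  field_simp
  ring

/-- **The implicitly defined pair `(ρ, u)` solves the Euler system.**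
Let `A : (0,∞) → ℝ` be `C¹`, `α₂ ≠ 0`, `P′(ρ) = A(ρ)²(ρ+α₃)/α₂`, and
`Φ(t,x,ρ) = P(ρ) + (α₁α₃−α₀)²/(2α₂(ρ+α₃)²)
  + (2x(ρ+α₃)² − 2t(ρ²α₁+α₃(α₀+2ρα₁)) − ρα₂(ρ+2α₃)t²)/(2(ρ+α₃)²)`.
Let `Ω ⊆ ℝ²` be open and `ρ : Ω → (0,∞)` be `C¹` with `ρ+α₃ ≠ 0`,
`Φ(t,x,ρ(t,x)) = 0` and `∂Φ/∂ρ ≠ 0` on `Ω`, and define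
`u = (α₂ρt + α₁ρ + α₀)/(ρ+α₃)`.  Then on `Ω`:
`ρ_t + (ρu)_x = 0` and `u_t + u u_x + ρ A(ρ)² ρ_x = 0`. -/
theorem implicit_solution_solves_euler
    (A P : ℝ → ℝ) (α₀ α₁ α₂ α₃ : ℝ) (hα₂ : α₂ ≠ 0)
    (hA : ContDiffOn ℝ 1 A (Set.Ioi 0))
    (hP : ∀ r ∈ Set.Ioi (0 : ℝ), HasDerivAt P (A r ^ 2 * (r + α₃) / α₂) r)
    (Φ : ℝ → ℝ → ℝ → ℝ)
    (hΦ : ∀ t x r : ℝ, Φ t x r =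
      P r + (α₁ * α₃ - α₀) ^ 2 / (2 * α₂ * (r + α₃) ^ 2) +
        (2 * x * (r + α₃) ^ 2 - 2 * t * (r ^ 2 * α₁ + α₃ * (α₀ + 2 * r * α₁)) -
            r * α₂ * (r + 2 * α₃) * t ^ 2) / (2 * (r + α₃) ^ 2))
    (Ω : Set (ℝ × ℝ)) (hΩ : IsOpen Ω)
    (ρ u : ℝ × ℝ → ℝ)
    (hρC1 : ContDiffOn ℝ 1 ρ Ω)
    (hρpos : ∀ q ∈ Ω, 0 < ρ q)
    (hρ₃ : ∀ q ∈ Ω, ρ q + α₃ ≠ 0)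
    (hsol : ∀ q ∈ Ω, Φ q.1 q.2 (ρ q) = 0)
    (hΦρ : ∀ q ∈ Ω, deriv (fun r => Φ q.1 q.2 r) (ρ q) ≠ 0)
    (hu : ∀ q ∈ Ω, u q = (α₂ * ρ q * q.1 + α₁ * ρ q + α₀) / (ρ q + α₃)) :
    ∀ q ∈ Ω,
      deriv (fun t' => ρ (t', q.2)) q.1 +
          deriv (fun x' => ρ (q.1, x') * u (q.1, x')) q.2 = 0 ∧
        deriv (fun t' => u (t', q.2)) q.1 +
            u q * deriv (fun x' => u (q.1, x')) q.2 +
            ρ q * A (ρ q) ^ 2 * deriv (fun x' => ρ (q.1, x')) q.2 = 0 := by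
  rintro ⟨t, x⟩ hq
  have hs := hρ₃ _ hq
  have hPq := hP _ (hρpos _ hq)
  have hρd : DifferentiableAt ℝ ρ (t, x) :=
    (hρC1.contDiffAt (hΩ.mem_nhds hq)).differentiableAt one_ne_zero
  have hct : HasDerivAt (fun v : ℝ => (v, x)) (1, 0) t :=
    (hasDerivAt_id t).prodMk (hasDerivAt_const t x)
  have hcx : HasDerivAt (fun v : ℝ => (t, v)) (0, 1) x :=
    (hasDerivAt_const x t).prodMk (hasDerivAt_id x)
  have hΩt : ∀ᶠ v in nhds t, (v, x) ∈ Ω := hct.continuousAt (hΩ.mem_nhds hq)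
  have hΩx : ∀ᶠ v in nhds x, (t, v) ∈ Ω := hcx.continuousAt (hΩ.mem_nhds hq)
  obtain ⟨a, ha⟩ : ∃ a, HasDerivAt (fun v => ρ (v, x)) a t :=
    ⟨_, hρd.hasFDerivAt.comp_hasDerivAt t hct⟩
  obtain ⟨b, hb⟩ : ∃ b, HasDerivAt (fun v => ρ (t, v)) b x :=
    ⟨_, hρd.hasFDerivAt.comp_hasDerivAt x hcx⟩
  have hΦt := hasDerivAt_phase (α₀ := α₀) (α₁ := α₁) hα₂ hs hPq
    (hasDerivAt_id t) (hasDerivAt_const t x) ha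
  have hΦx := hasDerivAt_phase (α₀ := α₀) (α₁ := α₁) hα₂ hs hPq
    (hasDerivAt_const x t) (hasDerivAt_id x) hb
  have hΦr := hasDerivAt_phase (α₀ := α₀) (α₁ := α₁) (R := fun r => r) hα₂ hs hPq
    (hasDerivAt_const _ t) (hasDerivAt_const _ x) (hasDerivAt_id (ρ (t, x)))
  have hEt := hΦt.unique ((hasDerivAt_const t (0 : ℝ)).congr_of_eventuallyEq
    (hΩt.mono fun v hv => (hΦ _ _ _).symm.trans (hsol _ hv)))
  have hEx := hΦx.unique ((hasDerivAt_const x (0 : ℝ)).congr_of_eventuallyEq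
    (hΩx.mono fun v hv => (hΦ _ _ _).symm.trans (hsol _ hv)))
  have hD := hΦρ _ hq
  simp only [hΦ] at hD
  rw [hΦr.deriv] at hD
  have hut := (hasDerivAt_velocity (α₀ := α₀) (α₁ := α₁) (α₂ := α₂) hs
    (hasDerivAt_id t) ha).congr_of_eventuallyEq (hΩt.mono fun v hv => hu _ hv)
  have hux := (hasDerivAt_velocity (α₀ := α₀) (α₁ := α₁) (α₂ := α₂) hs
    (hasDerivAt_const x t) hb).congr_of_eventuallyEq (hΩx.mono fun v hv => hu _ hv)
  have hρu := (hb.mul hux).deriv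
  simp only [Pi.mul_def] at hρu
  simp only [ha.deriv, hb.deriv, hut.deriv, hux.deriv, hρu, hu _ hq]
  simp only [id, mul_one, mul_zero, add_zero, zero_add] at hEt hEx hD ⊢
  generalize ρ (t, x) = r at *
  generalize A r ^ 2 = c at *
  set D := c * (r + α₃) / α₂ -
    (α₃ * α₂ * t + (α₁ * α₃ - α₀)) ^ 2 / (α₂ * (r + α₃) ^ 3) with hDdef
  have hc : c = (α₂ * D + (α₃ * α₂ * t + (α₁ * α₃ - α₀)) ^ 2 / (r + α₃) ^ 3) / (r + α₃) := by
    rw [hDdef]; field_simp; ring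
  have hb' : b = -1 / D := by
    rw [eq_div_iff hD]; linarith
  have ha' : a = (α₁ + α₂ * t -
      α₃ * (α₃ * α₂ * t + (α₁ * α₃ - α₀)) / (r + α₃) ^ 2) / D := by
    rw [eq_div_iff hD]; linarith
  clear_value D
  subst hc hb' ha'
  constructor <;> field_simp <;> ring
end

section
/- Let A : (0,∞) → ℝ be continuous, let α₀, α₁, α₃ ∈ ℝ and α₂ ≠ 0, and let Q : (0,∞) → ℝ satisfy Q′(ρ) = ρ(ρ+α₃)A(ρ)²/α₂, and P : (0,∞) → ℝ satisfy P′(ρ) = A(ρ)²(ρ+α₃)/α₂. On the set of (ρ,t) with ρ > 0 and ρ + α₃ ≠ 0, define g(ρ,t) = −P(ρ) + [ α₂²t²ρ(ρ+2α₃) + 2tα₂( α₃(α₀ + 2α₁ρ) + α₁ρ² ) − (α₀ − α₁α₃)² ] / (2α₂(ρ+α₃)²), U(ρ,t) = (α₂ρt + α₁ρ + α₀)/(ρ+α₃), and H(ρ,t) = (α₂ρt − α₁α₃ + α₀)·( α₁α₃² + α₃((tα₂ + 2α₁)ρ − α₀) − 2ρα₀ ) / (2α₂(ρ+α₃)²)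 − Q(ρ). Then ∂H/∂ρ = ρ·∂g/∂ρ and ∂H/∂t = ρ·( ∂g/∂t − U(ρ,t) ) at every point of the domain. -/
/-- **`H` is a potential of the restricted conservation law `Θ|_N`.**
Let `A : (0,∞) → ℝ` be continuous, `α₂ ≠ 0`, and `Q, P` satisfy
`Q′(ρ) = ρ(ρ+α₃)A(ρ)²/α₂`, `P′(ρ) = A(ρ)²(ρ+α₃)/α₂` on `(0,∞)`.  For
`ρ > 0`, `ρ+α₃ ≠ 0`, define
`g(ρ,t) = −P(ρ) + (α₂²t²ρ(ρ+2α₃) + 2tα₂(α₃(α₀+2α₁ρ)+α₁ρ²) − (α₀−α₁α₃)²)/(2α₂(ρ+α₃)²)`,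
`U(ρ,t) = (α₂ρt+α₁ρ+α₀)/(ρ+α₃)`,
`H(ρ,t) = (α₂ρt−α₁α₃+α₀)(α₁α₃²+α₃((tα₂+2α₁)ρ−α₀)−2ρα₀)/(2α₂(ρ+α₃)²) − Q(ρ)`.
Then `∂H/∂ρ = ρ ∂g/∂ρ` and `∂H/∂t = ρ(∂g/∂t − U)`. -/
theorem potential_of_conservation_law
    (A Q P : ℝ → ℝ) (α₀ α₁ α₂ α₃ : ℝ) (hα₂ : α₂ ≠ 0)
    (hA : ContinuousOn A (Set.Ioi 0))
    (hQ : ∀ r ∈ Set.Ioi (0 : ℝ), HasDerivAt Q (r * (r + α₃) * A r ^ 2 / α₂) r)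
    (hP : ∀ r ∈ Set.Ioi (0 : ℝ), HasDerivAt P (A r ^ 2 * (r + α₃) / α₂) r)
    (g U H : ℝ → ℝ → ℝ)
    (hg : ∀ r t : ℝ, g r t = -P r +
      (α₂ ^ 2 * t ^ 2 * r * (r + 2 * α₃) +
          2 * t * α₂ * (α₃ * (α₀ + 2 * α₁ * r) + α₁ * r ^ 2) -
          (α₀ - α₁ * α₃) ^ 2) / (2 * α₂ * (r + α₃) ^ 2))
    (hU : ∀ r t : ℝ, U r t = (α₂ * r * t + α₁ * r + α₀) / (r + α₃))
    (hH : ∀ r t : ℝ, H r t =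
      (α₂ * r * t - α₁ * α₃ + α₀) *
          (α₁ * α₃ ^ 2 + α₃ * ((t * α₂ + 2 * α₁) * r - α₀) - 2 * r * α₀) /
          (2 * α₂ * (r + α₃) ^ 2) - Q r)
    (ρ t : ℝ) (hρ : 0 < ρ) (hρ₃ : ρ + α₃ ≠ 0) :
    deriv (fun r => H r t) ρ = ρ * deriv (fun r => g r t) ρ ∧
      deriv (fun t' => H ρ t') t = ρ * (deriv (fun t' => g ρ t') t - U ρ t) := by
  have hden : 2 * α₂ * (ρ + α₃) ^ 2 ≠ 0 := by positivity
  have hden_deriv : HasDerivAt (fun r => 2 * α₂ * (r + α₃) ^ 2)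
      (2 * α₂ * (2 * (ρ + α₃))) ρ := by
    have h := (((hasDerivAt_id' ρ).add_const α₃).pow 2).const_mul (2 * α₂)
    exact h.congr_deriv (by norm_num)
  have hg_r : deriv (fun r => g r t) ρ =
      -(A ρ ^ 2 * (ρ + α₃) / α₂) +
        ((α₂ ^ 2 * t ^ 2 * (2 * ρ + 2 * α₃) + 2 * t * α₂ * (2 * α₁ * α₃ + 2 * α₁ * ρ)) *
          (2 * α₂ * (ρ + α₃) ^ 2) -
          (α₂ ^ 2 * t ^ 2 * ρ * (ρ + 2 * α₃) +
          2 * t * α₂ * (α₃ * (α₀ + 2 * α₁ * ρ) + α₁ * ρ ^ 2) - (α₀ - α₁ * α₃) ^ 2) *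
          (2 * α₂ * (2 * (ρ + α₃)))) / (2 * α₂ * (ρ + α₃) ^ 2) ^ 2 := by
    simp only [hg]
    have hnum : HasDerivAt (fun r => α₂ ^ 2 * t ^ 2 * r * (r + 2 * α₃) +
        2 * t * α₂ * (α₃ * (α₀ + 2 * α₁ * r) + α₁ * r ^ 2) - (α₀ - α₁ * α₃) ^ 2)
        (α₂ ^ 2 * t ^ 2 * (2 * ρ + 2 * α₃) + 2 * t * α₂ * (2 * α₁ * α₃ + 2 * α₁ * ρ)) ρ := by
      have h₁ := ((hasDerivAt_id' ρ).const_mul (α₂ ^ 2 * t ^ 2)).mul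
        ((hasDerivAt_id' ρ).add_const (2 * α₃))
      have h₂ := (((((hasDerivAt_id' ρ).const_mul (2 * α₁)).const_add α₀).const_mul α₃).add
        (((hasDerivAt_id' ρ).pow 2).const_mul α₁)).const_mul (2 * t * α₂)
      exact ((h₁.add h₂).sub_const ((α₀ - α₁ * α₃) ^ 2)).congr_deriv (by push_cast; ring)
    exact ((hP ρ hρ).neg.add (hnum.div hden_deriv hden)).deriv
  have hH_r : deriv (fun r => H r t) ρ =
      ((α₂ * t * (α₁ * α₃ ^ 2 + α₃ * ((t * α₂ + 2 * α₁) * ρ - α₀) - 2 * ρ * α₀) +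
          (α₂ * ρ * t - α₁ * α₃ + α₀) * (α₃ * (t * α₂ + 2 * α₁) - 2 * α₀)) *
          (2 * α₂ * (ρ + α₃) ^ 2) -
          (α₂ * ρ * t - α₁ * α₃ + α₀) * (α₁ * α₃ ^ 2 + α₃ * ((t * α₂ + 2 * α₁) * ρ - α₀) - 2 * ρ * α₀) *
          (2 * α₂ * (2 * (ρ + α₃)))) / (2 * α₂ * (ρ + α₃) ^ 2) ^ 2 -
        ρ * (ρ + α₃) * A ρ ^ 2 / α₂ := by
    simp only [hH]
    have h₁ : HasDerivAt (fun r => α₂ * r * t - α₁ * α₃ + α₀) (α₂ * t) ρ :=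
      (((((hasDerivAt_id' ρ).const_mul α₂).mul_const t).sub_const (α₁ * α₃)).add_const
        α₀).congr_deriv (by ring)
    have h₂ : HasDerivAt
        (fun r => α₁ * α₃ ^ 2 + α₃ * ((t * α₂ + 2 * α₁) * r - α₀) - 2 * r * α₀)
        (α₃ * (t * α₂ + 2 * α₁) - 2 * α₀) ρ :=
      ((((((hasDerivAt_id' ρ).const_mul (t * α₂ + 2 * α₁)).sub_const α₀).const_mul
        α₃).const_add (α₁ * α₃ ^ 2)).sub
        (((hasDerivAt_id' ρ).const_mul 2).mul_const α₀)).congr_deriv (by ring)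
    exact (((h₁.mul h₂).div hden_deriv hden).sub (hQ ρ hρ)).deriv
  have hg_t : deriv (fun t' => g ρ t') t =
      (2 * α₂ ^ 2 * t * ρ * (ρ + 2 * α₃) +
        2 * α₂ * (α₃ * (α₀ + 2 * α₁ * ρ) + α₁ * ρ ^ 2)) / (2 * α₂ * (ρ + α₃) ^ 2) := by
    simp only [hg]
    have hnum : HasDerivAt (fun s => α₂ ^ 2 * s ^ 2 * ρ * (ρ + 2 * α₃) +
        2 * s * α₂ * (α₃ * (α₀ + 2 * α₁ * ρ) + α₁ * ρ ^ 2) - (α₀ - α₁ * α₃) ^ 2)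
        (2 * α₂ ^ 2 * t * ρ * (ρ + 2 * α₃) +
          2 * α₂ * (α₃ * (α₀ + 2 * α₁ * ρ) + α₁ * ρ ^ 2)) t := by
      have h₁ := ((((hasDerivAt_id' t).pow 2).const_mul (α₂ ^ 2)).mul_const ρ).mul_const
        (ρ + 2 * α₃)
      have h₂ := (((hasDerivAt_id' t).const_mul 2).mul_const α₂).mul_const
        (α₃ * (α₀ + 2 * α₁ * ρ) + α₁ * ρ ^ 2)
      exact ((h₁.add h₂).sub_const ((α₀ - α₁ * α₃) ^ 2)).congr_deriv (by push_cast; ring)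
    exact ((hnum.div_const _).const_add (-P ρ)).deriv
  have hH_t : deriv (fun t' => H ρ t') t =
      (α₂ * ρ * (α₁ * α₃ ^ 2 + α₃ * ((t * α₂ + 2 * α₁) * ρ - α₀) - 2 * ρ * α₀) +
        (α₂ * ρ * t - α₁ * α₃ + α₀) * (α₃ * α₂ * ρ)) / (2 * α₂ * (ρ + α₃) ^ 2) := by
    simp only [hH]
    have h₁ : HasDerivAt (fun s => α₂ * ρ * s - α₁ * α₃ + α₀) (α₂ * ρ) t :=
      ((((hasDerivAt_id' t).const_mul (α₂ * ρ)).sub_const (α₁ * α₃)).add_const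
        α₀).congr_deriv (by ring)
    have h₂ : HasDerivAt
        (fun s => α₁ * α₃ ^ 2 + α₃ * ((s * α₂ + 2 * α₁) * ρ - α₀) - 2 * ρ * α₀)
        (α₃ * α₂ * ρ) t :=
      ((((((((hasDerivAt_id' t).mul_const α₂).add_const (2 * α₁)).mul_const ρ).sub_const
        α₀).const_mul α₃).const_add (α₁ * α₃ ^ 2)).sub_const (2 * ρ * α₀)).congr_deriv
        (by ring)
    exact (((h₁.mul h₂).div_const _).sub_const (Q ρ)).deriv
  rw [hH_r, hg_r, hH_t, hg_t, hU]
  constructor <;> field_simp <;> ring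
end
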